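/- Let X be an element of a unital associative ℚ(q)-algebra. Then for all c, t ∈ ℕ: C_q(X; −c, t) = Σ_{p=0}^{t} (−1)^p q^{−t(c+p) + p(p+1)/2} binom_q(p+c−1, p) C_q(X; 0, t−p), where binom_q(−1, 0) := 1 (so that for c = 0 only the p = 0 term contributes). -/

import Mathlib

open Finset

noncomputable section

/-- The base field `ℚ(q)` of rational functions over `ℚ`. -/
abbrev K : Type := RatFunc ℚ

/-- The indeterminate `q`. -/
def q : K := RatFunc.X

/-- The `x`-number `(n)_x = (x^n - 1)/(x - 1)`. -/
def qn (x : K) (n : ℕ) : K := (x ^ n - 1) / (x - 1)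

/-- The `x`-factorial `(n)_x!`. -/
def qnFact (x : K) (n : ℕ) : K := ∏ r ∈ Finset.Icc 1 n, qn x r

/-- The `x`-binomial coefficient `binom_x(n,s)`, zero when `s > n`. -/
def qBinom (x : K) (n s : ℕ) : K :=
  if s ≤ n then qnFact x n / (qnFact x s * qnFact x (n - s)) else 0

/-- The balanced `q`-integer `[n]_q = (q^n - q^{-n})/(q - q^{-1})`. -/
def qint (n : ℕ) : K := (q ^ n - q⁻¹ ^ n) / (q - q⁻¹)

/-- The balanced `q`-factorial `[n]_q!`. -/
def qintFact (n : ℕ) : K := ∏ r ∈ Finset.Icc 1 n, qint r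

variable {A : Type*} [Ring A] [Algebra K A]

/-- The `q`-divided power `X^{(n)} = X^n / [n]_q!`. -/
def dp (X : A) (n : ℕ) : A := (qintFact n)⁻¹ • X ^ n

/-- The `q`-binomial coefficient `C_q(X; c, n) = ∏_{s=1}^n (q^{c+1-s} X - 1)/(q^s - 1)`. -/
def Cq (X : A) (c : ℤ) : ℕ → A
  | 0 => 1
  | n + 1 => (q ^ ((n : ℤ) + 1) - 1)⁻¹ • (Cq X c n * (q ^ (c - (n : ℤ)) • X - 1))

/-- The bracket `{X; c | n, r} = Σ_{s=0}^r q^{s(s+1)/2} binom_q(r,s) C_q(X; c+s, n-r)`. -/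
def Sq (X : A) (c : ℤ) (n r : ℕ) : A :=
  ∑ s ∈ Finset.range (r + 1),
    (q ^ (s * (s + 1) / 2) * qBinom q r s) • Cq X (c + (s : ℤ)) (n - r)

end

theorem q_ne_zero : q ≠ 0 := RatFunc.X_ne_zero

theorem q_pow_succ_sub_one_ne_zero (n : ℕ) : q ^ (n + 1) - 1 ≠ 0 := by
  intro h
  have h1 : algebraMap (Polynomial ℚ) (RatFunc ℚ) (Polynomial.X ^ (n + 1) - 1) = 0 := by
    simpa [q] using h
  rw [map_eq_zero_iff _ (RatFunc.algebraMap_injective ℚ)] at h1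
  exact (Polynomial.monic_X_pow_sub_C (1 : ℚ) n.succ_ne_zero).ne_zero (by simpa using h1)

theorem qn_succ_ne_zero (n : ℕ) : qn q (n + 1) ≠ 0 :=
  div_ne_zero (q_pow_succ_sub_one_ne_zero n) (by simpa using q_pow_succ_sub_one_ne_zero 0)

theorem qnFact_succ (x : K) (n : ℕ) : qnFact x (n + 1) = qnFact x n * qn x (n + 1) :=
  Finset.prod_Icc_succ_top (by omega) _

theorem qnFact_ne_zero (n : ℕ) : qnFact q n ≠ 0 := by
  induction n with
  | zero => simp [qnFact]
  | succ n ih => rw [qnFact_succ]; exact mul_ne_zero ih (qn_succ_ne_zero n)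

theorem qn_add (x : K) (m n : ℕ) : qn x (m + n) = qn x m + x ^ m * qn x n := by
  unfold qn
  ring

theorem qBinom_zero_right (n : ℕ) : qBinom q n 0 = 1 := by
  simpa [qBinom, qnFact] using qnFact_ne_zero n

theorem qBinom_self (n : ℕ) : qBinom q n n = 1 := by
  simpa [qBinom, qnFact] using qnFact_ne_zero n

theorem qBinom_of_lt (x : K) {n s : ℕ} (h : n < s) : qBinom x n s = 0 := by
  simp [qBinom, h]

theorem qBinom_add_left (x : K) (s m : ℕ) :
    qBinom x (s + m) s = qnFact x (s + m) / (qnFact x s * qnFact x m) := by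
  simp [qBinom]

/-- The `q`-Pascal rule. -/
theorem qBinom_succ_succ (s m : ℕ) :
    qBinom q (s + m + 1) (s + 1) = qBinom q (s + m) (s + 1) + q ^ m * qBinom q (s + m) s := by
  cases m with
  | zero => simp [qBinom_self, qBinom_of_lt]
  | succ d =>
    have e1 : s + (d + 1) + 1 = (s + 1) + (d + 1) := by ring
    have e2 : s + (d + 1) = (s + 1) + d := by ring
    have h1 := qBinom_add_left q (s + 1) (d + 1)
    have h2 := qBinom_add_left q (s + 1) d
    have h3 := qBinom_add_left q s (d + 1)
    rw [← e1, qnFact_succ, e1, add_comm (s + 1) (d + 1), qn_add, add_comm (d + 1) (s + 1)] at h1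
    rw [← e2] at h2
    rw [e1, h1, h2, h3, qnFact_succ q s, qnFact_succ q d]
    have := qnFact_ne_zero s
    have := qnFact_ne_zero d
    have := qn_succ_ne_zero s
    have := qn_succ_ne_zero d
    field_simp

section Cq

variable {A : Type*} [Ring A] [Algebra K A] (X : A)

theorem Cq_succ (c : ℤ) (n : ℕ) :
    Cq X c (n + 1) = (q ^ (n + 1) - 1)⁻¹ • (Cq X c n * (q ^ (c - (n : ℤ)) • X - 1)) := by
  rw [Cq]
  norm_cast

theorem Cq_add_one_succ_eq_mul (c : ℤ) (n : ℕ) :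
    Cq X (c + 1) (n + 1) = (q ^ (n + 1) - 1)⁻¹ • (Cq X c n * (q ^ (c + 1) • X - 1)) := by
  induction n with
  | zero => simp [Cq]
  | succ n ih =>
    rw [Cq_succ, ih, Cq_succ X c n]
    have e : c + 1 - ((n + 1 : ℕ) : ℤ) = c - n := by push_cast; ring
    rw [e]
    simp only [smul_mul_assoc, mul_assoc]
    congr 3
    simp only [mul_sub, sub_mul, mul_one, one_mul, smul_mul_assoc, mul_smul_comm, smul_sub]
    rw [smul_comm]
    abel

/-- The Pascal rule `C_q(X; c+1, n+1) = q^{n+1} C_q(X; c, n+1) + C_q(X; c, n)`. -/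
theorem Cq_add_one_succ (c : ℤ) (n : ℕ) :
    Cq X (c + 1) (n + 1) = q ^ (n + 1) • Cq X c (n + 1) + Cq X c n := by
  have h := q_pow_succ_sub_one_ne_zero n
  apply smul_right_injective A h
  have e : q ^ (n + 1) * q ^ (c - (n : ℤ)) = q ^ (c + 1) := by
    rw [← zpow_natCast, ← zpow_add₀ q_ne_zero]
    congr 1
    push_cast
    ring
  simp only [smul_add]
  rw [smul_comm _ (q ^ (n + 1)), Cq_add_one_succ_eq_mul, Cq_succ, smul_inv_smul₀ h,
    smul_inv_smul₀ h, ← e]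
  simp only [mul_sub, mul_one, mul_smul_comm, smul_smul, smul_sub, sub_smul, one_smul]
  abel

theorem Cq_neg_succ (c : ℤ) (n : ℕ) :
    Cq X (-(c + 1)) (n + 1) =
      (q ^ (n + 1))⁻¹ • (Cq X (-c) (n + 1) - Cq X (-(c + 1)) n) := by
  have h := Cq_add_one_succ X (-(c + 1)) n
  rw [show -(c + 1) + 1 = -c by ring] at h
  rw [h, add_sub_cancel_right, inv_smul_smul₀ (pow_ne_zero _ q_ne_zero)]

end Cq

/-- The coefficient of `C_q(X; 0, t - p)` in the expansion of `C_q(X; -c, t)`. -/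
noncomputable def negCoeff (c t p : ℕ) : K :=
  (-1 : K) ^ p * q ^ (-((t : ℤ) * ((c : ℤ) + p)) + ((p * (p + 1) / 2 : ℕ) : ℤ)) *
    qBinom q (p + c - 1) p

theorem negCoeff_zero_right (c t : ℕ) : negCoeff c t 0 = q ^ (-((t : ℤ) * c)) := by
  simp [negCoeff, qBinom_zero_right]

theorem negCoeff_zero_left_succ (t p : ℕ) : negCoeff 0 t (p + 1) = 0 := by
  simp [negCoeff, qBinom_of_lt]

theorem negCoeff_succ_succ_zero (c t : ℕ) :
    negCoeff (c + 1) (t + 1) 0 = (q ^ (t + 1))⁻¹ * negCoeff c (t + 1) 0 := by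
  rw [negCoeff_zero_right, negCoeff_zero_right, ← zpow_natCast, ← zpow_neg,
    ← zpow_add₀ q_ne_zero]
  congr 1
  push_cast
  ring

theorem negCoeff_succ_succ_succ (c t p : ℕ) :
    negCoeff (c + 1) (t + 1) (p + 1) =
      (q ^ (t + 1))⁻¹ * (negCoeff c (t + 1) (p + 1) - negCoeff (c + 1) t p) := by
  have e : (p + 1) * (p + 1 + 1) / 2 = p * (p + 1) / 2 + (p + 1) := by
    rw [show (p + 1) * (p + 1 + 1) = p * (p + 1) + (p + 1) * 2 by ring,
      Nat.add_mul_div_right _ _ two_pos]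
  unfold negCoeff
  rw [show p + 1 + (c + 1) - 1 = p + c + 1 by omega, show p + 1 + c - 1 = p + c by omega,
    show p + (c + 1) - 1 = p + c by omega, qBinom_succ_succ, e]
  generalize p * (p + 1) / 2 = m
  set E : ℤ := -((t + 1 : ℤ) * (c + p + 1)) + (m + (p + 1))
  have h1 : q ^ (-(((t + 1 : ℕ) : ℤ) * (((c + 1 : ℕ) : ℤ) + ((p + 1 : ℕ) : ℤ))) +
      ((m + (p + 1) : ℕ) : ℤ)) = (q ^ (t + 1))⁻¹ * q ^ E := by
    rw [← zpow_natCast, ← zpow_neg, ← zpow_add₀ q_ne_zero]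
    congr 1
    simp only [E]
    push_cast
    ring
  have h2 : q ^ (-(((t + 1 : ℕ) : ℤ) * ((c : ℤ) + ((p + 1 : ℕ) : ℤ))) +
      ((m + (p + 1) : ℕ) : ℤ)) = q ^ E := by
    congr 1
  have h3 : q ^ (-((t : ℤ) * (((c + 1 : ℕ) : ℤ) + (p : ℤ))) + (m : ℤ)) = q ^ E * q ^ c := by
    rw [← zpow_natCast q c, ← zpow_add₀ q_ne_zero]
    congr 1
    simp only [E]
    push_cast
    ring
  rw [h1, h2, h3]
  ring

theorem Cq_neg_eq_sum {A : Type*} [Ring A] [Algebra K A] (X : A) (c t : ℕ) :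
    Cq X (-(c : ℤ)) t = ∑ p ∈ Finset.range (t + 1), negCoeff c t p • Cq X 0 (t - p) := by
  induction c generalizing t with
  | zero => simp [Finset.sum_range_succ', negCoeff_zero_left_succ, negCoeff_zero_right]
  | succ c ihc =>
    induction t with
    | zero => simp [Cq, negCoeff_zero_right]
    | succ t iht =>
      have h := Cq_neg_succ X c t
      push_cast at iht ⊢
      rw [h, ihc, iht, Finset.sum_range_succ', Finset.sum_range_succ' _ (t + 1)]
      simp only [negCoeff_succ_succ_succ, negCoeff_succ_succ_zero, Nat.add_sub_add_right, mul_smul,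
        sub_smul, smul_sub, smul_add, Finset.sum_sub_distrib, Finset.smul_sum]
      abel

theorem statement19 {A : Type*} [Ring A] [Algebra K A] (X : A) (c t : ℕ) :
    Cq X (-(c : ℤ)) t =
      ∑ p ∈ Finset.range (t + 1),
        ((-1 : K) ^ p *
            q ^ (-((t : ℤ) * ((c : ℤ) + p)) + ((p * (p + 1) / 2 : ℕ) : ℤ)) *
            qBinom q (p + c - 1) p) • Cq X 0 (t - p) := by
  exact Cq_neg_eq_sum X c t
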